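/- arXiv:1810.02693 — 12 statements merged into one kernel-verified Lean document; each statement's English description precedes it below -/
import Mathlib

section
/- Let Φ be the 10×10 rational matrix whose rows are (0,0,0,0,0,0,0,1,0,−1), (1,0,0,0,0,0,0,0,0,2), (0,1,0,0,0,0,0,0,0,−1), (0,0,1,0,0,0,0,0,0,0), (0,0,0,1,0,0,0,0,0,1), (0,0,0,0,1,0,0,0,0,−1), (0,0,0,0,0,1,0,0,0,1), (0,0,0,0,0,0,1,0,0,0), (0,0,0,0,0,0,0,0,0,−1), (0,0,0,0,0,0,0,0,1,2). Then the minimal polynomial of Φ over ℚ equals (X+1)(X⁴+1)(X²+1)(X−1)³. -/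
open Polynomial

/-- The matrix of the push-forward action on the Picard group. -/
def picardMatrix : Matrix (Fin 10) (Fin 10) ℚ :=
  !![0,0,0,0,0,0,0,1,0,-1;
     1,0,0,0,0,0,0,0,0,2;
     0,1,0,0,0,0,0,0,0,-1;
     0,0,1,0,0,0,0,0,0,0;
     0,0,0,1,0,0,0,0,0,1;
     0,0,0,0,1,0,0,0,0,-1;
     0,0,0,0,0,1,0,0,0,1;
     0,0,0,0,0,0,1,0,0,0;
     0,0,0,0,0,0,0,0,0,-1;
     0,0,0,0,0,0,0,0,1,2]

/-- The rows are the iterates `Φ ^ i *ᵥ e₈`, for `i < 10`, of the cyclic vector `e₈`. -/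
def krylovMatrix : Matrix (Fin 10) (Fin 10) ℚ :=
  !![0,0,0,0,0,0,0,0,1,0;
     0,0,0,0,0,0,0,0,0,1;
     -1,2,-1,0,1,-1,1,0,-1,2;
     -2,3,0,-1,2,-1,1,1,-2,3;
     -2,4,0,0,2,-1,2,1,-3,4;
     -3,6,0,0,4,-2,3,2,-4,5;
     -3,7,1,0,5,-1,3,3,-5,6;
     -3,9,1,1,6,-1,5,3,-6,7;
     -4,11,2,1,8,-1,6,5,-7,8;
     -3,12,3,2,9,0,7,6,-8,9]

theorem picardMatrix_pow_eight_mul :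
    picardMatrix ^ 8 * (picardMatrix - 1) ^ 2 = (picardMatrix - 1) ^ 2 := by
  decide +kernel

theorem picardMatrix_pow_apply_eight (i j : Fin 10) :
    (picardMatrix ^ (i : ℕ)) j 8 = krylovMatrix i j := by
  have h : Matrix.of (fun i j : Fin 10 => (picardMatrix ^ (i : ℕ)) j 8) = krylovMatrix := by
    decide +kernel
  exact congrFun (congrFun h i) j

theorem eq_zero_of_krylovMatrix_combination (c : Fin 10 → ℚ)
    (h : ∀ j, ∑ i, c i * krylovMatrix i j = 0) : c = 0 := by
  have h0 := h 0
  have h1 := h 1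
  have h2 := h 2
  have h3 := h 3
  have h4 := h 4
  have h5 := h 5
  have h6 := h 6
  have h7 := h 7
  have h8 := h 8
  have h9 := h 9
  simp [Fin.sum_univ_succ, krylovMatrix] at h0 h1 h2 h3 h4 h5 h6 h7 h8 h9
  ext i
  fin_cases i <;> simp <;> linarith

theorem eq_zero_of_aeval_picardMatrix_eq_zero (q : ℚ[X]) (hq : q.natDegree < 10)
    (h : aeval picardMatrix q = 0) : q = 0 := by
  rw [aeval_eq_sum_range' hq, Finset.sum_range] at h
  have hc : (fun i : Fin 10 => q.coeff i) = 0 := by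
    refine eq_zero_of_krylovMatrix_combination _ fun j => ?_
    have hj := congrFun (congrFun h j) 8
    simpa only [Matrix.sum_apply, Matrix.smul_apply, smul_eq_mul,
      picardMatrix_pow_apply_eight, Matrix.zero_apply] using hj
  ext n
  by_cases hn : n < 10
  · exact congrFun hc ⟨n, hn⟩
  · exact coeff_eq_zero_of_natDegree_lt (by omega)

/-- The minimal polynomial of the 10×10 matrix representing the push-forward
action on the Picard group for the QRT mapping `x_{n+1} x_{n-1} = (x_n+1)/x_n²`
is `(X+1)(X⁴+1)(X²+1)(X−1)³`. -/
theorem stmt_7 (Φ : Matrix (Fin 10) (Fin 10) ℚ)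
    (hΦ : Φ = !![0,0,0,0,0,0,0,1,0,-1;
                 1,0,0,0,0,0,0,0,0,2;
                 0,1,0,0,0,0,0,0,0,-1;
                 0,0,1,0,0,0,0,0,0,0;
                 0,0,0,1,0,0,0,0,0,1;
                 0,0,0,0,1,0,0,0,0,-1;
                 0,0,0,0,0,1,0,0,0,1;
                 0,0,0,0,0,0,1,0,0,0;
                 0,0,0,0,0,0,0,0,0,-1;
                 0,0,0,0,0,0,0,0,1,2]) :
    minpoly ℚ Φ = (X + 1) * (X ^ 4 + 1) * (X ^ 2 + 1) * (X - 1) ^ 3 := by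
  obtain rfl : Φ = picardMatrix := hΦ
  have hp : ((X + 1) * (X ^ 4 + 1) * (X ^ 2 + 1) * (X - 1) ^ 3 : ℚ[X]) =
      X ^ 8 * (X - 1) ^ 2 - (X - 1) ^ 2 := by ring
  have hdeg : ((X + 1) * (X ^ 4 + 1) * (X ^ 2 + 1) * (X - 1) ^ 3 : ℚ[X]).natDegree = 10 := by
    compute_degree!
  have hmonic : ((X + 1) * (X ^ 4 + 1) * (X ^ 2 + 1) * (X - 1) ^ 3 : ℚ[X]).Monic := by
    monicity!
  refine (minpoly.unique ℚ picardMatrix hmonic ?_ fun q hq hq0 => ?_).symm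
  · simp [hp, picardMatrix_pow_eight_mul]
  · have : 10 ≤ q.natDegree := by
      by_contra! hlt
      exact hq.ne_zero (eq_zero_of_aeval_picardMatrix_eq_zero q hlt hq0)
    rw [degree_eq_natDegree hmonic.ne_zero, degree_eq_natDegree hq.ne_zero, hdeg]
    exact_mod_cast this
end

section
/- Let k ≥ 2 be an even integer and u ∈ ℂ. Define, for ε ∈ ℂ, ε ≠ 0, the iterates of the mapping x_{n+1} = x_n^{−k} − x_{n−1} starting from x_{n−1} = u, x_n = ε: namely x₁(ε) = ε^{−k} − u, x₂(ε) = x₁(ε)^{−k} − ε, and x₃(ε) = x₂(ε)^{−k} − x₁(ε). Then, as ε → 0 along nonzero values (the punctured neighborhood filter 𝓝[≠] 0 in ℂ), x₂(ε) tends to 0 and x₃(ε) tends to u. -/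
open Filter

/-- The geometric-sum form of `(1 - w)⁻ᵏ - 1`, exhibiting the factor `w`. -/
theorem inv_one_sub_pow_sub_one {K : Type*} [Field K] {w : K} (hw : 1 - w ≠ 0) (k : ℕ) :
    ((1 - w)⁻¹) ^ k - 1 = w * ((1 - w)⁻¹ * ∑ i ∈ Finset.range k, ((1 - w)⁻¹) ^ i) := by
  have h : (1 - w)⁻¹ - 1 = w * (1 - w)⁻¹ := by
    field_simp
    ring
  rw [← mul_geom_sum, h]
  ring

/-- Singularity confinement for `x_{n+1} + x_{n-1} = 1/x_n^k` with `k` even: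
entering the singularity at `0`, the iterates pass through `∞` and `0` and
then recover the initial datum `u`. -/
theorem stmt_8 (k : ℕ) (hk : 2 ≤ k) (hke : Even k) (u : ℂ)
    (x₁ x₂ x₃ : ℂ → ℂ)
    (h₁ : ∀ ε : ℂ, x₁ ε = (ε⁻¹) ^ k - u)
    (h₂ : ∀ ε : ℂ, x₂ ε = ((x₁ ε)⁻¹) ^ k - ε)
    (h₃ : ∀ ε : ℂ, x₃ ε = ((x₂ ε)⁻¹) ^ k - x₁ ε) :
    Tendsto x₂ (nhdsWithin 0 {0}ᶜ) (nhds 0) ∧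
      Tendsto x₃ (nhdsWithin 0 {0}ᶜ) (nhds u) := by
  have hk0 : k ≠ 0 := by omega
  obtain ⟨n, hn⟩ : ∃ n, k * k = k + n + 2 :=
    ⟨k * k - k - 2, by have : 2 * k ≤ k * k := Nat.mul_le_mul_right k hk; omega⟩
  let A : ℂ → ℂ := fun ε => ((1 - u * ε ^ k)⁻¹) ^ k
  let w : ℂ → ℂ := fun ε => ε ^ (k + n + 1) * A ε
  let v : ℂ → ℂ := fun ε => (1 - w ε)⁻¹
  have hw0 : w 0 = 0 := by simp [w]
  have hA : ContinuousAt A 0 :=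
    ((by fun_prop : ContinuousAt (fun ε : ℂ => 1 - u * ε ^ k) 0).inv₀ (by simp [hk0])).pow k
  have hw : ContinuousAt w 0 := (continuousAt_id.pow _).mul hA
  have hv : ContinuousAt v 0 := (continuousAt_const.sub hw).inv₀ (by simp [hw0])
  have hx₂ : ∀ ε : ℂ, ε ≠ 0 → x₂ ε = -(ε * (1 - w ε)) := by
    intro ε hε
    have h : x₁ ε = (ε ^ k)⁻¹ * (1 - u * ε ^ k) := by
      rw [h₁, inv_pow]
      field_simp
    have hpow : (ε ^ k) ^ k = ε * ε ^ (k + n + 1) := by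
      rw [← pow_mul, hn]
      ring
    rw [h₂, h, mul_inv, inv_inv, mul_pow, hpow]
    simp only [w, A]
    ring
  have hx₃ : ∀ ε : ℂ, ε ≠ 0 → 1 - w ε ≠ 0 →
      x₃ ε = u + ε ^ (n + 1) * (A ε * (v ε * ∑ i ∈ Finset.range k, v ε ^ i)) := by
    intro ε hε hne
    have hvk : v ε ^ k = 1 + w ε * (v ε * ∑ i ∈ Finset.range k, v ε ^ i) :=
      eq_add_of_sub_eq' (inv_one_sub_pow_sub_one hne k)
    have hcancel : (ε⁻¹) ^ k * w ε = ε ^ (n + 1) * A ε := by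
      simp only [w, add_assoc, pow_add ε k]
      rw [inv_pow, ← mul_assoc, inv_mul_cancel_left₀ (pow_ne_zero k hε)]
    rw [h₃, h₁, hx₂ ε hε, inv_neg, hke.neg_pow, mul_inv, mul_pow]
    change (ε⁻¹) ^ k * v ε ^ k - _ = _
    rw [hvk]
    linear_combination (v ε * ∑ i ∈ Finset.range k, v ε ^ i) * hcancel
  have hne : ∀ᶠ ε in nhdsWithin (0 : ℂ) {0}ᶜ, 1 - w ε ≠ 0 :=
    ((continuousAt_const.sub hw).eventually_ne (by simp [hw0])).filter_mono nhdsWithin_le_nhds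
  constructor
  · have hc : ContinuousAt (fun ε => -(ε * (1 - w ε))) 0 :=
      (continuousAt_id.mul (continuousAt_const.sub hw)).neg
    have ht := hc.tendsto.mono_left (nhdsWithin_le_nhds (s := {0}ᶜ))
    simp only [zero_mul, neg_zero] at ht
    refine ht.congr' ?_
    filter_upwards [self_mem_nhdsWithin] with ε hε using (hx₂ ε hε).symm
  · have hc : ContinuousAt
        (fun ε => u + ε ^ (n + 1) * (A ε * (v ε * ∑ i ∈ Finset.range k, v ε ^ i))) 0 := by
      fun_prop
    have ht := hc.tendsto.mono_left (nhdsWithin_le_nhds (s := {0}ᶜ))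
    simp only [ne_eq, Nat.add_eq_zero_iff, one_ne_zero, and_false, not_false_eq_true, zero_pow,
      zero_mul, add_zero] at ht
    refine ht.congr' ?_
    filter_upwards [self_mem_nhdsWithin, hne] with ε hε h using (hx₃ ε hε h).symm
end

section
/- Let k ≥ 3 be an odd integer and u ∈ ℂ. Define, for ε ∈ ℂ, ε ≠ 0, x₁(ε) = ε^{−k} − u, x₂(ε) = x₁(ε)^{−k} − ε, and x₃(ε) = x₂(ε)^{−k} − x₁(ε). Then the norm ‖x₃(ε)‖ tends to +∞ as ε → 0 along nonzero values (the punctured neighborhood filter 𝓝[≠] 0 in ℂ). -/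
open Filter

/-- Non-confinement for `x_{n+1} + x_{n-1} = 1/x_n^k` with `k ≥ 3` odd: the
third iterate after the singularity at `0` diverges. -/
theorem stmt_9 (k : ℕ) (hk : 3 ≤ k) (hko : Odd k) (u : ℂ)
    (x₁ x₂ x₃ : ℂ → ℂ)
    (h₁ : ∀ ε : ℂ, x₁ ε = (ε⁻¹) ^ k - u)
    (h₂ : ∀ ε : ℂ, x₂ ε = ((x₁ ε)⁻¹) ^ k - ε)
    (h₃ : ∀ ε : ℂ, x₃ ε = ((x₂ ε)⁻¹) ^ k - x₁ ε) :
    Tendsto (fun ε => ‖x₃ ε‖) (nhdsWithin 0 {0}ᶜ) atTop := by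
  obtain ⟨m, rfl⟩ : ∃ m, k = m + 1 := ⟨k - 1, by omega⟩
  have hm : m ≠ 0 := by omega
  -- `x₁ = ε⁻ᵏ g`, `x₂ = ε q` and `x₃ = ε⁻ᵏ (q⁻ᵏ - g)` with `g → 1` and `q → -1`
  set g : ℂ → ℂ := fun ε => 1 - u * ε ^ (m + 1) with hg
  set q : ℂ → ℂ := fun ε => ε ^ m * (g ε)⁻¹ * (ε ^ (m + 1) * (g ε)⁻¹) ^ m - 1 with hq
  have g_zero : g 0 = 1 := by simp [hg]
  have q_zero : q 0 = -1 := by simp [hq, hm]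
  have g_cont : ContinuousAt g 0 := by fun_prop
  have g_inv_cont : ContinuousAt (fun ε => (g ε)⁻¹) 0 := g_cont.inv₀ (by simp [g_zero])
  have q_cont : ContinuousAt q 0 := by fun_prop
  have q_inv_cont : ContinuousAt (fun ε => (q ε)⁻¹) 0 := q_cont.inv₀ (by simp [q_zero])
  have factor_cont : ContinuousAt (fun ε => ‖((q ε)⁻¹) ^ (m + 1) - g ε‖) 0 := by fun_prop
  have factor_zero : ‖((q 0)⁻¹) ^ (m + 1) - g 0‖ = 2 := by
    rw [q_zero, g_zero, inv_neg, inv_one, hko.neg_one_pow]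
    norm_num
  have factor_lim : Tendsto (fun ε => ‖((q ε)⁻¹) ^ (m + 1) - g ε‖)
      (nhdsWithin 0 {0}ᶜ) (nhds 2) :=
    factor_zero ▸ factor_cont.tendsto.mono_left nhdsWithin_le_nhds
  have pole_lim : Tendsto (fun ε : ℂ => ‖ε⁻¹‖ ^ (m + 1)) (nhdsWithin 0 {0}ᶜ) atTop :=
    (tendsto_pow_atTop m.succ_ne_zero).comp
      (tendsto_norm_cobounded_atTop.comp tendsto_inv₀_nhdsNE_zero)
  refine (pole_lim.atTop_mul_pos two_pos factor_lim).congr' ?_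
  filter_upwards [self_mem_nhdsWithin] with ε hε
  have hε : ε ≠ 0 := hε
  have e₁ : x₁ ε = (ε⁻¹) ^ (m + 1) * g ε := by
    rw [h₁, hg, inv_pow]
    field_simp
  have e₂ : x₂ ε = ε * q ε := by
    rw [h₂, e₁, mul_inv, inv_pow, inv_inv, pow_succ _ m, hq]
    ring
  rw [h₃, e₂, e₁, mul_inv, mul_pow, ← mul_sub, norm_mul, norm_pow]
end

section
/- Let u ∈ ℂ with u ≠ 0. For ε ∈ ℂ, ε ≠ 0, define the iterates of the mapping x_{n+1} = (x_n + 1)/(x_{n−1} x_n²) starting from x_{n−1} = u, x_n = −1 + ε: x₁(ε) = ε/(u(ε−1)²), x₂(ε) = (x₁(ε)+1)/((−1+ε)·x₁(ε)²), x₃(ε) = (x₂(ε)+1)/(x₁(ε)·x₂(ε)²), x₄(ε) = (x₃(ε)+1)/(x₂(ε)·x₃(ε)²). Then, as ε → 0 along nonzero values (the punctured neighborhood filter 𝓝[≠] 0 in ℂ): x₁(ε) → 0, ‖x₂(ε)‖ → +∞, x₃(ε) → 0, and x₄(ε) → −1. -/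
open Filter

/-- The confined singularity pattern `(−1, 0, ∞², 0, −1)` of the QRT mapping
`x_{n+1} x_{n-1} = (x_n+1)/x_n²`. -/
theorem stmt_10 (u : ℂ) (hu : u ≠ 0) (x₁ x₂ x₃ x₄ : ℂ → ℂ)
    (h₁ : ∀ ε : ℂ, x₁ ε = ε / (u * (ε - 1) ^ 2))
    (h₂ : ∀ ε : ℂ, x₂ ε = (x₁ ε + 1) / ((-1 + ε) * (x₁ ε) ^ 2))
    (h₃ : ∀ ε : ℂ, x₃ ε = (x₂ ε + 1) / (x₁ ε * (x₂ ε) ^ 2))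
    (h₄ : ∀ ε : ℂ, x₄ ε = (x₃ ε + 1) / (x₂ ε * (x₃ ε) ^ 2)) :
    Tendsto x₁ (nhdsWithin 0 {0}ᶜ) (nhds 0) ∧
      Tendsto (fun ε => ‖x₂ ε‖) (nhdsWithin 0 {0}ᶜ) atTop ∧
      Tendsto x₃ (nhdsWithin 0 {0}ᶜ) (nhds 0) ∧
      Tendsto x₄ (nhdsWithin 0 {0}ᶜ) (nhds (-1)) := by
  have hε : Tendsto (fun ε : ℂ => ε) (nhdsWithin 0 {0}ᶜ) (nhds 0) :=
    tendsto_id.mono_left nhdsWithin_le_nhds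
  have hb : Tendsto (fun ε : ℂ => -1 + ε) (nhdsWithin 0 {0}ᶜ) (nhds (-1)) := by
    simpa using hε.const_add (-1)
  have ha : Tendsto x₁ (nhdsWithin 0 {0}ᶜ) (nhds 0) := by
    rw [funext h₁]
    simpa [Pi.div_def] using hε.div (((hε.sub_const 1).pow 2).const_mul u) (by simpa using hu)
  have ha1 : Tendsto (fun ε => x₁ ε + 1) (nhdsWithin 0 {0}ᶜ) (nhds 1) := by
    simpa using ha.add_const 1
  have hc : Tendsto (fun ε => x₁ ε + 1 + (-1 + ε) * x₁ ε ^ 2) (nhdsWithin 0 {0}ᶜ) (nhds 1) := by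
    simpa using ha1.add (hb.mul (ha.pow 2))
  have hb0 := hb.eventually_ne (neg_ne_zero.mpr one_ne_zero)
  have ha10 := ha1.eventually_ne one_ne_zero
  have hc0 := hc.eventually_ne one_ne_zero
  have ha0 : ∀ᶠ ε in nhdsWithin 0 {0}ᶜ, x₁ ε ≠ 0 := by
    filter_upwards [hb0, self_mem_nhdsWithin] with ε hb hε
    rw [h₁]
    exact div_ne_zero hε (mul_ne_zero hu (pow_ne_zero 2 (by rwa [sub_eq_neg_add])))
  have hx₂ : Tendsto (fun ε => ‖x₂ ε‖) (nhdsWithin 0 {0}ᶜ) atTop := by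
    have hinv : Tendsto (fun ε => (x₂ ε)⁻¹) (nhdsWithin 0 {0}ᶜ) (nhdsWithin 0 {0}ᶜ) := by
      refine tendsto_nhdsWithin_iff.mpr ⟨?_, ?_⟩
      · simp only [h₂, inv_div]
        simpa [Pi.div_def] using (hb.mul (ha.pow 2)).div ha1 one_ne_zero
      · filter_upwards [hb0, ha10, ha0] with ε hb ha1 ha
        rw [h₂]
        exact inv_ne_zero (div_ne_zero ha1 (mul_ne_zero hb (pow_ne_zero 2 ha)))
    simpa [Function.comp_def] using
      tendsto_norm_cobounded_atTop.comp (tendsto_inv₀_nhdsNE_zero.comp hinv)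
  have hx₃_eq : ∀ᶠ ε in nhdsWithin 0 {0}ᶜ,
      x₃ ε = (x₁ ε + 1 + (-1 + ε) * x₁ ε ^ 2) * (-1 + ε) * x₁ ε / (x₁ ε + 1) ^ 2 := by
    filter_upwards [hb0, ha10, ha0] with ε hb ha1 ha
    rw [h₃, h₂]
    field_simp
  have hx₃ : Tendsto x₃ (nhdsWithin 0 {0}ᶜ) (nhds 0) := by
    refine Tendsto.congr' (hx₃_eq.mono fun _ h => h.symm) ?_
    simpa [Pi.div_def] using ((hc.mul hb).mul ha).div (ha1.pow 2) (by simp)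
  refine ⟨ha, hx₂, hx₃, ?_⟩
  have hx₄_eq : ∀ᶠ ε in nhdsWithin 0 {0}ᶜ, (x₃ ε + 1) * (x₁ ε + 1) ^ 3 /
      ((x₁ ε + 1 + (-1 + ε) * x₁ ε ^ 2) ^ 2 * (-1 + ε)) = x₄ ε := by
    filter_upwards [hb0, ha10, ha0, hc0, hx₃_eq] with ε hb ha1 ha hc h
    have hden : x₂ ε * x₃ ε ^ 2 =
        (x₁ ε + 1 + (-1 + ε) * x₁ ε ^ 2) ^ 2 * (-1 + ε) / (x₁ ε + 1) ^ 3 := by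
      rw [h, h₂]
      field_simp
    rw [h₄, hden, div_div_eq_mul_div]
  refine Tendsto.congr' hx₄_eq ?_
  simpa [Pi.div_def] using ((hx₃.add_const 1).mul (ha1.pow 3)).div ((hc.pow 2).mul hb) (by simp)
end

section
/- Let u ∈ ℂ with u ≠ 0. For ε ∈ ℂ, ε ≠ 0, define the iterates of the mapping x_{n+1} = (x_n + 1)/(x_{n−1} x_n²) starting from x_{n−1} = u, x_n = ε: x₁(ε) = (ε+1)/(u ε²), x₂(ε) = (x₁(ε)+1)/(ε·x₁(ε)²), x₃(ε) = (x₂(ε)+1)/(x₁(ε)·x₂(ε)²). Then, as ε → 0 along nonzero values (the punctured neighborhood filter 𝓝[≠] 0 in ℂ), x₃(ε) tends to 1/u. -/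
open Filter

/-- Part of the cyclic singularity pattern `(x₀, 0, ∞², 0, x₀′, ∞, 0, ∞)` of
the QRT mapping `x_{n+1} x_{n-1} = (x_n+1)/x_n²`: after the singularity at
`0` the iterates return to `1/u`. -/
theorem stmt_11 (u : ℂ) (hu : u ≠ 0) (x₁ x₂ x₃ : ℂ → ℂ)
    (h₁ : ∀ ε : ℂ, x₁ ε = (ε + 1) / (u * ε ^ 2))
    (h₂ : ∀ ε : ℂ, x₂ ε = (x₁ ε + 1) / (ε * (x₁ ε) ^ 2))
    (h₃ : ∀ ε : ℂ, x₃ ε = (x₂ ε + 1) / (x₁ ε * (x₂ ε) ^ 2)) :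
    Tendsto x₃ (nhdsWithin 0 {0}ᶜ) (nhds u⁻¹) := by
  have hD : Tendsto (fun ε : ℂ => ε + 1 + u * ε ^ 2) (nhds 0) (nhds 1) :=
    Continuous.tendsto' (by fun_prop) _ _ (by simp)
  have ha : Tendsto (fun ε : ℂ => ε + 1) (nhds 0) (nhds 1) :=
    Continuous.tendsto' (by fun_prop) _ _ (by simp)
  have hlim : Tendsto
      (fun ε : ℂ => ((ε + 1 + u * ε ^ 2) * u * ε + (ε + 1) ^ 2) * (ε + 1) /
        (u * (ε + 1 + u * ε ^ 2) ^ 2)) (nhds 0) (nhds u⁻¹) := by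
    have hc : ContinuousAt
        (fun ε : ℂ => ((ε + 1 + u * ε ^ 2) * u * ε + (ε + 1) ^ 2) * (ε + 1) /
          (u * (ε + 1 + u * ε ^ 2) ^ 2)) 0 :=
      ContinuousAt.div (by fun_prop) (by fun_prop) (by simpa using hu)
    simpa [ContinuousAt] using hc
  refine (hlim.mono_left nhdsWithin_le_nhds).congr' ?_
  filter_upwards [self_mem_nhdsWithin,
    nhdsWithin_le_nhds (hD.eventually_ne one_ne_zero),
    nhdsWithin_le_nhds (ha.eventually_ne one_ne_zero)] with ε hε hDε haε
  have hε0 : ε ≠ 0 := hε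
  have hx₂ : x₂ ε = (ε + 1 + u * ε ^ 2) * u * ε / (ε + 1) ^ 2 := by
    rw [h₂, h₁]
    field_simp
  rw [h₃, hx₂, h₁]
  generalize ε + 1 + u * ε ^ 2 = D at hDε ⊢
  field_simp
end

section
/- Let k ≥ 2 be an even integer and u ∈ ℂ. For ε ∈ ℂ, ε ≠ 0, define the iterates of the mapping x_{n+1} = x_n + x_n^{−k} − x_{n−1} starting from x_{n−1} = u, x_n = ε: x₁(ε) = ε + ε^{−k} − u, x₂(ε) = x₁(ε) + x₁(ε)^{−k} − ε, x₃(ε) = x₂(ε) + x₂(ε)^{−k} − x₁(ε), x₄(ε) = x₃(ε) + x₃(ε)^{−k} − x₂(ε). Then, as ε → 0 along nonzero values (the punctured neighborhood filter 𝓝[≠] 0 in ℂ), x₃(ε) tends to 0 and x₄(ε) tends to u. -/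
open Filter

/-- Rescaling `z` by `ε ^ k` extracts the factor `ε ^ (k * k)` from `z⁻¹ ^ k`. -/
lemma inv_pow_eq_pow_mul_inv_mul_pow {ε : ℂ} (hε : ε ≠ 0) (k : ℕ) (z : ℂ) :
    z⁻¹ ^ k = ε ^ (k * k) * (z * ε ^ k)⁻¹ ^ k := by
  have h : (ε ^ k) ^ k ≠ 0 := pow_ne_zero _ (pow_ne_zero _ hε)
  rw [mul_inv, mul_pow, inv_pow (ε ^ k), pow_mul]
  field_simp

/-- The confined singularity pattern `(0, ∞^k, ∞^k, 0)` of the family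
`x_{n+1} + x_{n-1} = x_n + 1/x_n^k` for even `k` (Hietarinta–Viallet at
`k = 2`). -/
theorem stmt_12 (k : ℕ) (hk : 2 ≤ k) (hke : Even k) (u : ℂ)
    (x₁ x₂ x₃ x₄ : ℂ → ℂ)
    (h₁ : ∀ ε : ℂ, x₁ ε = ε + (ε⁻¹) ^ k - u)
    (h₂ : ∀ ε : ℂ, x₂ ε = x₁ ε + ((x₁ ε)⁻¹) ^ k - ε)
    (h₃ : ∀ ε : ℂ, x₃ ε = x₂ ε + ((x₂ ε)⁻¹) ^ k - x₁ ε)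
    (h₄ : ∀ ε : ℂ, x₄ ε = x₃ ε + ((x₃ ε)⁻¹) ^ k - x₂ ε) :
    Tendsto x₃ (nhdsWithin 0 {0}ᶜ) (nhds 0) ∧
      Tendsto x₄ (nhdsWithin 0 {0}ᶜ) (nhds u) := by
  obtain ⟨m, hm⟩ : ∃ m, k * k = m + k + 2 :=
    ⟨k * k - k - 2, by have : 2 * k ≤ k * k := Nat.mul_le_mul_right k hk
                       omega⟩
  have hne : ∀ᶠ ε : ℂ in nhdsWithin 0 {0}ᶜ, ε ≠ 0 := self_mem_nhdsWithin
  have hid : Tendsto (fun ε : ℂ => ε) (nhdsWithin 0 {0}ᶜ) (nhds 0) :=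
    tendsto_id.mono_left nhdsWithin_le_nhds
  have hpow (n : ℕ) (hn : n ≠ 0) :
      Tendsto (fun ε : ℂ => ε ^ n) (nhdsWithin 0 {0}ᶜ) (nhds 0) := by
    simpa [hn] using hid.pow n
  have hinv {f : ℂ → ℂ} (hf : Tendsto f (nhdsWithin 0 {0}ᶜ) (nhds 1)) :
      Tendsto (fun ε => (f ε)⁻¹ ^ k) (nhdsWithin 0 {0}ᶜ) (nhds 1) := by
    simpa using (hf.inv₀ one_ne_zero).pow k
  have hx₁ : Tendsto (fun ε => x₁ ε * ε ^ k) (nhdsWithin 0 {0}ᶜ) (nhds 1) := by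
    have h : Tendsto (fun ε : ℂ => ε ^ (k + 1) + 1 - u * ε ^ k)
        (nhdsWithin 0 {0}ᶜ) (nhds 1) := by
      simpa using ((hpow (k + 1) (by omega)).add_const 1).sub
        ((hpow k (by omega)).const_mul u)
    refine h.congr' ?_
    filter_upwards [hne] with ε hε
    have h0 : (ε⁻¹) ^ k * ε ^ k = 1 := by rw [← mul_pow, inv_mul_cancel₀ hε, one_pow]
    rw [h₁]
    linear_combination -h0
  set a : ℂ → ℂ := fun ε => (x₁ ε * ε ^ k)⁻¹ ^ k with ha
  have hta : Tendsto a (nhdsWithin 0 {0}ᶜ) (nhds 1) := hinv hx₁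
  have hp (ε : ℂ) (hε : ε ≠ 0) : (x₁ ε)⁻¹ ^ k = ε ^ (k * k) * a ε :=
    inv_pow_eq_pow_mul_inv_mul_pow hε k _
  have hx₂ : Tendsto (fun ε => x₂ ε * ε ^ k) (nhdsWithin 0 {0}ᶜ) (nhds 1) := by
    have h : Tendsto (fun ε : ℂ => x₁ ε * ε ^ k + ε ^ (k * k) * a ε * ε ^ k - ε ^ (k + 1))
        (nhdsWithin 0 {0}ᶜ) (nhds 1) := by
      simpa using (hx₁.add (((hpow (k * k) (by omega)).mul hta).mul
        (hpow k (by omega)))).sub (hpow (k + 1) (by omega))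
    refine h.congr' ?_
    filter_upwards [hne] with ε hε
    rw [h₂, hp ε hε]
    ring
  set b : ℂ → ℂ := fun ε => (x₂ ε * ε ^ k)⁻¹ ^ k with hb
  have htb : Tendsto b (nhdsWithin 0 {0}ᶜ) (nhds 1) := hinv hx₂
  have hq (ε : ℂ) (hε : ε ≠ 0) : (x₂ ε)⁻¹ ^ k = ε ^ (k * k) * b ε :=
    inv_pow_eq_pow_mul_inv_mul_pow hε k _
  set δ : ℂ → ℂ := fun ε => ε ^ (m + k + 1) * (a ε + b ε) with hδ
  have htδ : Tendsto δ (nhdsWithin 0 {0}ᶜ) (nhds 0) := by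
    simpa using (hpow (m + k + 1) (by omega)).mul (hta.add htb)
  have hx₃ (ε : ℂ) (hε : ε ≠ 0) : x₃ ε = -(ε * (1 - δ ε)) := by
    rw [h₃, hq ε hε, h₂, hp ε hε, hm]
    simp only [hδ]
    ring
  have ht₃ : Tendsto x₃ (nhdsWithin 0 {0}ᶜ) (nhds 0) := by
    have h : Tendsto (fun ε => -(ε * (1 - δ ε))) (nhdsWithin 0 {0}ᶜ) (nhds 0) := by
      simpa using (hid.mul (htδ.const_sub 1)).neg
    refine h.congr' ?_
    filter_upwards [hne] with ε hε
    exact (hx₃ ε hε).symm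
  refine ⟨ht₃, ?_⟩
  set g : ℂ → ℂ := fun z => (1 - z)⁻¹ ^ k with hg
  have hgd : DifferentiableAt ℂ g 0 :=
    (((differentiableAt_const 1).sub differentiableAt_id).inv (by simp)).pow k
  have hslope : Tendsto (fun ε => dslope g 0 (δ ε)) (nhdsWithin 0 {0}ᶜ)
      (nhds (dslope g 0 0)) :=
    (continuousAt_dslope_same.2 hgd).tendsto.comp htδ
  have hgδ (z : ℂ) : g z = 1 + z * dslope g 0 z := by
    have h := sub_smul_dslope g 0 z
    have h0 : g 0 = 1 := by simp [hg]
    rw [sub_zero, smul_eq_mul, h0] at h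
    linear_combination -h
  have h : Tendsto (fun ε => x₃ ε + u - ε ^ (k * k) * a ε
      + ε ^ (m + 1) * (a ε + b ε) * dslope g 0 (δ ε)) (nhdsWithin 0 {0}ᶜ) (nhds u) := by
    simpa using ((ht₃.add_const u).sub ((hpow (k * k) (by omega)).mul hta)).add
      (((hpow (m + 1) (by omega)).mul (hta.add htb)).mul hslope)
  refine h.congr' ?_
  filter_upwards [hne] with ε hε
  have hr : (x₃ ε)⁻¹ ^ k = ε⁻¹ ^ k * g (δ ε) := by
    rw [hx₃ ε hε, inv_neg, hke.neg_pow, mul_inv, mul_pow]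
  have h0 : (ε⁻¹) ^ k * ε ^ k = 1 := by rw [← mul_pow, inv_mul_cancel₀ hε, one_pow]
  have hδε : δ ε = ε ^ k * (ε ^ (m + 1) * (a ε + b ε)) := by
    simp only [hδ]
    ring
  rw [h₄, hr, hgδ, h₂, hp ε hε, h₁]
  linear_combination (-(ε ^ (m + 1) * (a ε + b ε) * dslope g 0 (δ ε))) * h0
    - ε⁻¹ ^ k * dslope g 0 (δ ε) * hδε
end

section
/- Let a, b, u ∈ ℂ with a ∉ {0,1}, b ∉ {0,1}, a ≠ b, and u ≠ 0. For ε ∈ ℂ, ε ≠ 0, define the iterates of the mapping x_{n+1} = a(x_n − b)/((x_n − 1) x_{n−1}) starting from x_{n−1} = u, x_n = 1 + ε: x₁(ε) = a(1+ε−b)/(ε u), x₂(ε) = a(x₁(ε)−b)/((x₁(ε)−1)·(1+ε)), x₃(ε) = a(x₂(ε)−b)/((x₂(ε)−1)·x₁(ε)), x₄(ε) = a(x₃(ε)−b)/((x₃(ε)−1)·x₂(ε)). Then, as ε → 0 along nonzero values (the punctured neighborhood filter 𝓝[≠] 0 in ℂ): ‖x₁(ε)‖ → +∞, x₂(ε)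 → a, x₃(ε) → 0, and x₄(ε) → b. -/
open Filter

/-- The confined singularity pattern `(1, ∞, a, 0, b)` of the mapping
`x_{n+1} x_{n-1} = a(x_n − b)/(x_n − 1)`. -/
theorem stmt_13 (a b u : ℂ) (ha0 : a ≠ 0) (ha1 : a ≠ 1) (hb0 : b ≠ 0)
    (hb1 : b ≠ 1) (hab : a ≠ b) (hu : u ≠ 0) (x₁ x₂ x₃ x₄ : ℂ → ℂ)
    (h₁ : ∀ ε : ℂ, x₁ ε = a * (1 + ε - b) / (ε * u))
    (h₂ : ∀ ε : ℂ, x₂ ε = a * (x₁ ε - b) / ((x₁ ε - 1) * (1 + ε)))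
    (h₃ : ∀ ε : ℂ, x₃ ε = a * (x₂ ε - b) / ((x₂ ε - 1) * x₁ ε))
    (h₄ : ∀ ε : ℂ, x₄ ε = a * (x₃ ε - b) / ((x₃ ε - 1) * x₂ ε)) :
    Tendsto (fun ε => ‖x₁ ε‖) (nhdsWithin 0 {0}ᶜ) atTop ∧
      Tendsto x₂ (nhdsWithin 0 {0}ᶜ) (nhds a) ∧
      Tendsto x₃ (nhdsWithin 0 {0}ᶜ) (nhds 0) ∧
      Tendsto x₄ (nhdsWithin 0 {0}ᶜ) (nhds b) := by
  have hid : Tendsto (fun ε : ℂ => ε) (nhdsWithin 0 {0}ᶜ) (nhds 0) :=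
    tendsto_id.mono_left nhdsWithin_le_nhds
  have hlin : Tendsto (fun ε : ℂ => a * (1 + ε - b)) (nhdsWithin 0 {0}ᶜ)
      (nhds (a * (1 + 0 - b))) :=
    ((hid.const_add 1).sub_const b).const_mul a
  have hlin0 : a * (1 + 0 - b) ≠ 0 :=
    mul_ne_zero ha0 (by rw [add_zero]; exact sub_ne_zero.mpr hb1.symm)
  have hinv : Tendsto (fun ε => (x₁ ε)⁻¹) (nhdsWithin 0 {0}ᶜ) (nhds 0) := by
    have h := (hid.mul_const u).div hlin hlin0
    rw [zero_mul, zero_div] at h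
    exact h.congr fun ε => by simp [h₁]
  have hx₁0 : ∀ᶠ ε in nhdsWithin 0 {0}ᶜ, x₁ ε ≠ 0 := by
    filter_upwards [hlin.eventually_ne hlin0, self_mem_nhdsWithin] with ε hε hε0
    rw [h₁]
    exact div_ne_zero hε (mul_ne_zero hε0 hu)
  have hx₁ : Tendsto (fun ε => ‖x₁ ε‖) (nhdsWithin 0 {0}ᶜ) atTop := by
    have h : Tendsto (fun ε => (x₁ ε)⁻¹) (nhdsWithin 0 {0}ᶜ) (nhdsWithin 0 {0}ᶜ) :=
      tendsto_nhdsWithin_iff.mpr ⟨hinv, hx₁0.mono fun ε hε => inv_ne_zero hε⟩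
    exact (tendsto_norm_cobounded_atTop.comp (tendsto_inv₀_nhdsNE_zero.comp h)).congr
      fun ε => by simp
  have hx₂ : Tendsto x₂ (nhdsWithin 0 {0}ᶜ) (nhds a) := by
    have h := (((hinv.const_mul b).const_sub 1).const_mul a).div
      ((hinv.const_sub 1).mul (hid.const_add 1)) (by norm_num)
    simp only [mul_zero, sub_zero, add_zero, mul_one, div_one] at h
    refine h.congr' ?_
    filter_upwards [hx₁0] with ε hε
    have hnum : a * (x₁ ε - b) = x₁ ε * (a * (1 - b * (x₁ ε)⁻¹)) := by
      field_simp
    have hden : (x₁ ε - 1) * (1 + ε) = x₁ ε * ((1 - (x₁ ε)⁻¹) * (1 + ε)) := by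
      field_simp
    rw [h₂, hnum, hden, mul_div_mul_left _ _ hε]
    rfl
  have hx₃ : Tendsto x₃ (nhdsWithin 0 {0}ᶜ) (nhds 0) := by
    have h := (((hx₂.sub_const b).const_mul a).div (hx₂.sub_const 1)
      (sub_ne_zero.mpr ha1)).mul hinv
    rw [mul_zero] at h
    exact h.congr fun ε => by
      rw [h₃, ← div_div, div_eq_mul_inv _ (x₁ ε)]
      rfl
  refine ⟨hx₁, hx₂, hx₃, ?_⟩
  have h := ((hx₃.sub_const b).const_mul a).div ((hx₃.sub_const 1).mul hx₂)
    (by simpa using ha0)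
  have hb : a * (0 - b) / ((0 - 1) * a) = b := by
    field_simp
    ring
  rw [hb] at h
  exact h.congr fun ε => (h₄ ε).symm
end

section
/- Let u ∈ ℂ with u ≠ 0. For ε ∈ ℂ, ε ≠ 0, define the iterates of the mapping x_{n+1} = (x_n⁴ − 1)/((x_n⁴ + 1) x_{n−1}) starting from x_{n−1} = u, x_n = 1 + ε: x₁(ε) = ((1+ε)⁴ − 1)/(((1+ε)⁴ + 1)·u) and x₂(ε) = (x₁(ε)⁴ − 1)/((x₁(ε)⁴ + 1)·(1+ε)). Then, as ε → 0 along nonzero values (the punctured neighborhood filter 𝓝[≠] 0 in ℂ), x₁(ε) tends to 0 and x₂(ε) tends to −1. -/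
open Filter

/-- The confined singularity pattern `(1, 0, −1)` of the mapping
`x_{n+1} x_{n-1} = (x_n⁴ − 1)/(x_n⁴ + 1)`. -/
theorem stmt_14 (u : ℂ) (hu : u ≠ 0) (x₁ x₂ : ℂ → ℂ)
    (h₁ : ∀ ε : ℂ, x₁ ε = ((1 + ε) ^ 4 - 1) / (((1 + ε) ^ 4 + 1) * u))
    (h₂ : ∀ ε : ℂ, x₂ ε = ((x₁ ε) ^ 4 - 1) / (((x₁ ε) ^ 4 + 1) * (1 + ε))) :
    Tendsto x₁ (nhdsWithin 0 {0}ᶜ) (nhds 0) ∧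
      Tendsto x₂ (nhdsWithin 0 {0}ᶜ) (nhds (-1)) := by
  have hx₁ : x₁ 0 = 0 := by simp [h₁]
  have hx₂ : x₂ 0 = -1 := by simp [h₂, hx₁]
  have hc₁ : ContinuousAt x₁ 0 := by
    rw [funext h₁]
    refine ContinuousAt.div (by fun_prop) (by fun_prop) (mul_ne_zero ?_ hu)
    norm_num
  have hc₂ : ContinuousAt x₂ 0 := by
    rw [funext h₂]
    refine ContinuousAt.div (by fun_prop) (by fun_prop) ?_
    simp [hx₁]
  refine ⟨?_, ?_⟩
  · simpa only [hx₁] using hc₁.tendsto.mono_left nhdsWithin_le_nhds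
  · simpa only [hx₂] using hc₂.tendsto.mono_left nhdsWithin_le_nhds
end

section
/- Let M : ℕ → ℤ satisfy M(0) = 0, M(1) = 1, and for all n ≥ 1, M(n+1) = 2·M(n) − M(n−1) + (1 if 4 divides n, 0 otherwise). Then for every integer m ≥ 2: M(2m) + M(2m−4) = m² + (1 if m is odd, 0 otherwise), and M(2m+1) + M(2m−3) = m² + m + 1. Equivalently, for all n ≥ 4, the quantity d_n := M(n) + M(n−4) equals n²/4 + 5/8 − (−1)ⁿ/8 − (iⁿ + (−i)ⁿ)/4. -/
/-- Closed form, on each residue class modulo 4, of the solution of the recurrence. -/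
theorem closed_form_of_recurrence (M : ℕ → ℤ) (h0 : M 0 = 0) (h1 : M 1 = 1)
    (hrec : ∀ n : ℕ, 1 ≤ n →
      M (n + 1) = 2 * M n - M (n - 1) + (if 4 ∣ n then 1 else 0)) (k : ℕ) :
    M (4 * k) = 2 * (k : ℤ) ^ 2 + 2 * k ∧
    M (4 * k + 1) = 2 * (k : ℤ) ^ 2 + 3 * k + 1 ∧
    M (4 * k + 2) = 2 * (k : ℤ) ^ 2 + 4 * k + 2 ∧
    M (4 * k + 3) = 2 * (k : ℤ) ^ 2 + 5 * k + 3 := by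
  have step (j : ℕ) : M (j + 2) = 2 * M (j + 1) - M j + (if 4 ∣ j + 1 then 1 else 0) :=
    hrec (j + 1) (by omega)
  have e2 (k : ℕ) : M (4 * k + 2) = 2 * M (4 * k + 1) - M (4 * k) := by
    rw [step, if_neg (by omega), add_zero]
  have e3 (k : ℕ) : M (4 * k + 3) = 2 * M (4 * k + 2) - M (4 * k + 1) := by
    rw [step (4 * k + 1), if_neg (by omega), add_zero]
  have e4 (k : ℕ) : M (4 * (k + 1)) = 2 * M (4 * k + 3) - M (4 * k + 2) := by
    rw [show 4 * (k + 1) = 4 * k + 2 + 2 by ring, step, if_neg (by omega), add_zero]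
  have e5 (k : ℕ) : M (4 * (k + 1) + 1) = 2 * M (4 * (k + 1)) - M (4 * k + 3) + 1 := by
    rw [show 4 * (k + 1) + 1 = 4 * k + 3 + 2 by ring, step, if_pos (by omega)]
    rfl
  have base : M (4 * k) = 2 * (k : ℤ) ^ 2 + 2 * k ∧
      M (4 * k + 1) = 2 * (k : ℤ) ^ 2 + 3 * k + 1 := by
    induction k with
    | zero => simp [h0, h1]
    | succ k ih =>
      obtain ⟨ha, hb⟩ := ih
      rw [e5, e4, e3, e2, ha, hb]
      push_cast
      constructor <;> ring
  obtain ⟨ha, hb⟩ := base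
  refine ⟨ha, hb, ?_, ?_⟩
  · rw [e2, ha, hb]; ring
  · rw [e3, e2, ha, hb]; ring

/-- Explicit solution of the recurrence from Halburd's method for the QRT
mapping `x_{n+1} x_{n-1} = (x_n+1)/x_n²`. -/
theorem stmt_15 (M : ℕ → ℤ) (h0 : M 0 = 0) (h1 : M 1 = 1)
    (hrec : ∀ n : ℕ, 1 ≤ n →
      M (n + 1) = 2 * M n - M (n - 1) + (if 4 ∣ n then 1 else 0)) :
    ∀ m : ℕ, 2 ≤ m →
      M (2 * m) + M (2 * m - 4) = (m : ℤ) ^ 2 + (if Odd m then 1 else 0) ∧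
      M (2 * m + 1) + M (2 * m - 3) = (m : ℤ) ^ 2 + m + 1 := by
  intro m hm
  have closed := closed_form_of_recurrence M h0 h1 hrec
  obtain ⟨k, rfl | rfl⟩ : ∃ k, m = 2 * (k + 1) ∨ m = 2 * (k + 1) + 1 :=
    ⟨m / 2 - 1, by omega⟩
  · obtain ⟨ha, hb, -, -⟩ := closed k
    obtain ⟨hc, hd, -, -⟩ := closed (k + 1)
    rw [if_neg (by rw [Nat.not_odd_iff_even]; exact even_two_mul _),
      show 2 * (2 * (k + 1)) - 4 = 4 * k by omega,
      show 2 * (2 * (k + 1)) - 3 = 4 * k + 1 by omega,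
      show 2 * (2 * (k + 1)) = 4 * (k + 1) by ring, ha, hb, hc, hd]
    push_cast
    constructor <;> ring
  · obtain ⟨-, -, ha, hb⟩ := closed k
    obtain ⟨-, -, hc, hd⟩ := closed (k + 1)
    rw [if_pos (odd_two_mul_add_one _),
      show 2 * (2 * (k + 1) + 1) - 4 = 4 * k + 2 by omega,
      show 2 * (2 * (k + 1) + 1) - 3 = 4 * k + 3 by omega,
      show 2 * (2 * (k + 1) + 1) = 4 * (k + 1) + 2 by ring, ha, hb, hc, hd]
    push_cast
    constructor <;> ring
end

section
/- Let k ≥ 4 be an even integer, set λ = (k + √(k²−4))/2 ∈ ℝ, and let Z : ℕ → ℝ satisfy Z(0) = 0, Z(1) = 1, and for all n ≥ 2, Z(n) = k·Z(n−1) − Z(n−2) + (1 if n is odd, 0 otherwise). Then for all n ≥ 0: Z(n) = 1/(2(2−k)) − (−1)ⁿ/(2(2+k)) + (λ^{n+1} + λ^{−(n+1)})/(k² − 4). -/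
/-- Explicit solution of the recurrence from Halburd's method for the mapping
`x_{n+1} + x_{n-1} = 1/x_n^k`, `k ≥ 4` even. -/
theorem stmt_16 (k : ℕ) (hk : 4 ≤ k) (hke : Even k) (lam : ℝ)
    (hlam : lam = ((k : ℝ) + Real.sqrt ((k : ℝ) ^ 2 - 4)) / 2)
    (Z : ℕ → ℝ) (h0 : Z 0 = 0) (h1 : Z 1 = 1)
    (hrec : ∀ n : ℕ, 2 ≤ n →
      Z n = k * Z (n - 1) - Z (n - 2) + (if Odd n then 1 else 0)) :
    ∀ n : ℕ, Z n = 1 / (2 * (2 - (k : ℝ)))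
      - (-1 : ℝ) ^ n / (2 * (2 + (k : ℝ)))
      + (lam ^ (n + 1) + lam ^ (-(n + 1 : ℤ))) / ((k : ℝ) ^ 2 - 4) := by
  have hk' : (4 : ℝ) ≤ k := by exact_mod_cast hk
  have hsq : Real.sqrt ((k : ℝ) ^ 2 - 4) ^ 2 = (k : ℝ) ^ 2 - 4 :=
    Real.sq_sqrt (by nlinarith)
  have hquad : lam * (k - lam) = 1 := by
    rw [hlam]
    linear_combination -hsq / 4
  have hinv : lam⁻¹ = k - lam := inv_eq_of_mul_eq_one_right hquad
  have hzpow (n : ℕ) : lam ^ (-(n + 1 : ℤ)) = (k - lam) ^ (n + 1) := by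
    rw [← hinv, inv_pow, zpow_neg]
    norm_cast
  have hm : (2 : ℝ) - k ≠ 0 := by linarith
  have hp : (2 : ℝ) + k ≠ 0 := by linarith
  have hd : (k : ℝ) ^ 2 - 4 = -((2 - k) * (2 + k)) := by ring
  intro n
  rw [hzpow, hd]
  induction n using Nat.twoStepInduction with
  | zero =>
    rw [h0]
    field_simp
    ring
  | one =>
    rw [h1]
    field_simp
    linear_combination -4 * hquad
  | more n ih₀ ih₁ =>
    have hodd : (if Odd (n + 2) then (1 : ℝ) else 0) = (1 - (-1) ^ n) / 2 := by
      rcases Nat.even_or_odd n with h | h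
      · have : ¬ Odd (n + 2) := by grind
        simp [this, h.neg_one_pow]
      · have : Odd (n + 2) := by grind
        simp only [this, if_true, h.neg_one_pow]
        norm_num
    have hstep := hrec (n + 2) (by omega)
    rw [hodd, show n + 2 - 1 = n + 1 from rfl, show n + 2 - 2 = n from rfl, ih₀, ih₁] at hstep
    have hpow : lam ^ (n + 2 + 1) + (k - lam) ^ (n + 2 + 1) =
        k * (lam ^ (n + 1 + 1) + (k - lam) ^ (n + 1 + 1))
          - (lam ^ (n + 1) + (k - lam) ^ (n + 1)) := by
      linear_combination -(lam ^ (n + 1) + (k - lam) ^ (n + 1)) * hquad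
    rw [hstep, hpow, pow_add (-1 : ℝ) n 2, pow_succ (-1 : ℝ) n]
    generalize lam ^ (n + 1 + 1) + (k - lam) ^ (n + 1 + 1) = a
    generalize lam ^ (n + 1) + (k - lam) ^ (n + 1) = b
    generalize (-1 : ℝ) ^ n = s
    field_simp
    ring
end

section
/- Let k ≥ 4 be an even integer, set λ = (k + √(k²−4))/2 ∈ ℝ, and let Z : ℕ → ℝ satisfy Z(0) = 0, Z(1) = 1, and for all n ≥ 2, Z(n) = k·Z(n−1) − Z(n−2) + (1 if n is odd, 0 otherwise). Define d(n) := Z(n) + Z(n−2) for n ≥ 2. Then for all n ≥ 2, d(n) = 1/(2−k) − (−1)ⁿ/(2+k) + k·(λⁿ + λ^{−n})/(k²−4), and the sequence d(n)^{1/n} converges to λ as n → ∞. -/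
open Filter

/-- A sequence of the form `c n * x ^ n`, with `c` converging to a positive limit and `x > 0`, has
`n`-th roots converging to `x`. -/
theorem tendsto_rpow_inv_of_eq_mul_pow {d c : ℕ → ℝ} {x l : ℝ} (hx : 0 < x) (hl : 0 < l)
    (hc : Tendsto c atTop (nhds l)) (hd : ∀ᶠ n in atTop, d n = c n * x ^ n) :
    Tendsto (fun n : ℕ => (d n) ^ ((n : ℝ)⁻¹)) atTop (nhds x) := by
  have hroot : Tendsto (fun n : ℕ => (c n) ^ ((n : ℝ)⁻¹) * x) atTop (nhds x) := by
    simpa using (hc.rpow tendsto_inv_atTop_nhds_zero_nat (Or.inl hl.ne')).mul_const x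
  refine hroot.congr' ?_
  filter_upwards [hd, hc.eventually (eventually_gt_nhds hl), eventually_ne_atTop 0]
    with n hdn hcn hn
  rw [hdn, Real.mul_rpow hcn.le (by positivity), Real.pow_rpow_inv_natCast hx.le hn]

/-- The solution of `u (n + 2) = (x + y) u (n + 1) - u n + (1 - (-1) ^ n)` with `x y = 1` that
starts from `x + y` and `(x + y) ^ 2 + 1`. -/
theorem eq_closed_form_of_recurrence {x y K : ℝ} (hxy : x * y = 1) (hK : x + y = K)
    (h2 : 2 - K ≠ 0) (h2' : 2 + K ≠ 0) {u : ℕ → ℝ} (hu0 : u 0 = K) (hu1 : u 1 = K ^ 2 + 1)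
    (hu : ∀ n, u (n + 2) = K * u (n + 1) - u n + (1 - (-1) ^ n)) (n : ℕ) :
    u n = 1 / (2 - K) - (-1) ^ n / (2 + K)
      + K * (x ^ (n + 2) + y ^ (n + 2)) / (K ^ 2 - 4) := by
  have h4 : K ^ 2 - 4 ≠ 0 := by
    rw [show K ^ 2 - 4 = -((2 - K) * (2 + K)) by ring]
    exact neg_ne_zero.2 (mul_ne_zero h2 h2')
  have hs : ∀ m, x ^ (m + 2) + y ^ (m + 2) = K * (x ^ (m + 1) + y ^ (m + 1)) - (x ^ m + y ^ m) := by
    intro m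
    rw [← hK]
    linear_combination (-(x ^ m + y ^ m)) * hxy
  have hp : ∀ e : ℝ, 1 / (2 - K) - e / (2 + K)
      = K * (1 / (2 - K) + e / (2 + K)) - (1 / (2 - K) - e / (2 + K)) + (1 - e) := by
    intro e
    field_simp
    ring
  have hsum : 1 / (2 - K) - 1 / (2 + K) = -(2 * K) / (K ^ 2 - 4) := by
    rw [div_sub_div _ _ h2 h2', div_eq_div_iff (mul_ne_zero h2 h2') h4]
    ring
  have hsum' : 1 / (2 - K) + 1 / (2 + K) = -4 / (K ^ 2 - 4) := by
    rw [div_add_div _ _ h2 h2', div_eq_div_iff (mul_ne_zero h2 h2') h4]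
    ring
  have hs2 : x ^ 2 + y ^ 2 = K ^ 2 - 2 := by
    rw [← hK]
    linear_combination (-2) * hxy
  have hs3 : x ^ 3 + y ^ 3 = K ^ 3 - 3 * K := by
    rw [← hK]
    linear_combination (-3 * (x + y)) * hxy
  induction n using Nat.twoStepInduction with
  | zero =>
    rw [hu0, pow_zero, hsum, hs2, ← add_div, eq_div_iff h4]
    ring
  | one =>
    rw [hu1, pow_one, neg_div, sub_neg_eq_add, hsum', hs3, ← add_div, eq_div_iff h4]
    ring
  | more n ih0 ih1 =>
    rw [hu, ih0, ih1, hs (n + 2)]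
    linear_combination -hp ((-1) ^ n)

/-- The degree sequence of the mapping `x_{n+1} + x_{n-1} = 1/x_n^k`, `k ≥ 4`
even, computed by Halburd's method, and its dynamical degree
`λ = (k + √(k²−4))/2`. -/
theorem stmt_18 (k : ℕ) (hk : 4 ≤ k) (hke : Even k) (lam : ℝ)
    (hlam : lam = ((k : ℝ) + Real.sqrt ((k : ℝ) ^ 2 - 4)) / 2)
    (Z : ℕ → ℝ) (h0 : Z 0 = 0) (h1 : Z 1 = 1)
    (hrec : ∀ n : ℕ, 2 ≤ n →
      Z n = k * Z (n - 1) - Z (n - 2) + (if Odd n then 1 else 0))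
    (d : ℕ → ℝ) (hd : ∀ n : ℕ, 2 ≤ n → d n = Z n + Z (n - 2)) :
    (∀ n : ℕ, 2 ≤ n → d n = 1 / (2 - (k : ℝ)) - (-1 : ℝ) ^ n / (2 + (k : ℝ))
      + (k : ℝ) * (lam ^ n + lam ^ (-(n : ℤ))) / ((k : ℝ) ^ 2 - 4)) ∧
    Tendsto (fun n : ℕ => (d n) ^ ((n : ℝ)⁻¹)) atTop (nhds lam) := by
  have hk4 : (4 : ℝ) ≤ k := by exact_mod_cast hk
  have hdisc : 0 < (k : ℝ) ^ 2 - 4 := by nlinarith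
  have hlam1 : 1 < lam := by
    rw [hlam]
    linarith [Real.sqrt_nonneg ((k : ℝ) ^ 2 - 4)]
  have hlam0 : 0 < lam := by linarith
  have hmul : lam * lam⁻¹ = 1 := mul_inv_cancel₀ hlam0.ne'
  have hquad : lam * lam = k * lam - 1 := by
    rw [hlam]
    linear_combination (1 / 4 : ℝ) * Real.mul_self_sqrt hdisc.le
  have hadd : lam + lam⁻¹ = k := by
    linear_combination lam⁻¹ * hquad - (lam - k) * hmul
  have hZ : ∀ n, Z (n + 2) = k * Z (n + 1) - Z n + (1 - (-1) ^ n) / 2 := by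
    intro n
    rw [hrec (n + 2) (by omega)]
    rcases Nat.even_or_odd n with h | h
    · simp [h.neg_one_pow, Nat.odd_add, Nat.not_odd_iff_even.2 h]
    · simp only [h.neg_one_pow, h.add_even even_two, if_true, Nat.add_sub_cancel,
        show n + 2 - 1 = n + 1 by omega]
      norm_num
  have hZ2 : Z 2 = k := by simpa [h0, h1] using hZ 0
  have hZ3 : Z 3 = k ^ 2 := by
    have := hZ 1
    norm_num [hZ2, h1] at this
    linear_combination this
  have hform : ∀ n : ℕ, 2 ≤ n → d n = 1 / (2 - (k : ℝ)) - (-1 : ℝ) ^ n / (2 + (k : ℝ))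
      + (k : ℝ) * (lam ^ n + lam⁻¹ ^ n) / ((k : ℝ) ^ 2 - 4) := by
    intro n hn
    obtain ⟨m, rfl⟩ := Nat.exists_eq_add_of_le' hn
    have hd' : ∀ m, d (m + 2) = Z (m + 2) + Z m := fun m => hd (m + 2) (by omega)
    have := eq_closed_form_of_recurrence (u := fun m => d (m + 2)) hmul hadd
      (by linarith) (by linarith) (by simp [hd', hZ2, h0]) (by simp [hd', hZ3, h1])
      (fun m => by
        simp only [hd', show m + 1 + 2 = m + 2 + 1 by ring]
        linear_combination hZ (m + 2) + hZ m) m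
    simpa [pow_add] using this
  refine ⟨fun n hn => by rw [hform n hn, zpow_neg, zpow_natCast, inv_pow], ?_⟩
  have hpow : Tendsto (fun n : ℕ => lam⁻¹ ^ n) atTop (nhds 0) :=
    tendsto_pow_atTop_nhds_zero_of_lt_one (by positivity) (inv_lt_one_of_one_lt₀ hlam1)
  have hpow' : Tendsto (fun n : ℕ => (-lam⁻¹) ^ n) atTop (nhds 0) :=
    tendsto_pow_atTop_nhds_zero_of_abs_lt_one (by
      rw [abs_neg, abs_of_pos (by positivity)]
      exact inv_lt_one_of_one_lt₀ hlam1)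
  refine tendsto_rpow_inv_of_eq_mul_pow (l := (k : ℝ) / ((k : ℝ) ^ 2 - 4)) hlam0
    (div_pos (by linarith) hdisc)
    (c := fun n => 1 / (2 - (k : ℝ)) * lam⁻¹ ^ n - 1 / (2 + (k : ℝ)) * (-lam⁻¹) ^ n
      + (k : ℝ) / ((k : ℝ) ^ 2 - 4) * (1 + lam⁻¹ ^ n * lam⁻¹ ^ n)) ?_ ?_
  · simpa using ((hpow.const_mul (1 / (2 - (k : ℝ)))).sub
      (hpow'.const_mul (1 / (2 + (k : ℝ))))).add
      (((hpow.mul hpow).const_add 1).const_mul ((k : ℝ) / ((k : ℝ) ^ 2 - 4)))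
  · filter_upwards [eventually_ge_atTop 2] with n hn
    have hn1 : lam⁻¹ ^ n * lam ^ n = 1 := by rw [← mul_pow, mul_comm, hmul, one_pow]
    rw [hform n hn, neg_pow lam⁻¹]
    linear_combination (-(1 / (2 - (k : ℝ))) + 1 / (2 + (k : ℝ)) * (-1) ^ n
      - (k : ℝ) / ((k : ℝ) ^ 2 - 4) * lam⁻¹ ^ n) * hn1
end

section
/- Let k ≥ 3 be an odd integer and let d : ℕ → ℤ satisfy d(0) = 0 and, for all n ≥ 1, d(n) = k·d(n−1) + (1 if n is odd, 0 otherwise). Then for every ℓ ≥ 0, (k² − 1)·d(2ℓ) = k·(k^{2ℓ} − 1), and for every ℓ ≥ 1, (k² − 1)·d(2ℓ−1) = k^{2ℓ} − 1; moreover the sequence (d(n))^{1/n} converges to k as n → ∞. -/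
open Filter

/-- A positive constant does not contribute to the `n`-th root growth rate. -/
theorem tendsto_const_mul_pow_rpow_inv {a c : ℝ} (ha : 0 ≤ a) (hc : 0 < c) :
    Tendsto (fun n : ℕ => (c * a ^ n) ^ ((n : ℝ)⁻¹)) atTop (nhds a) := by
  have hroot : Tendsto (fun n : ℕ => c ^ ((n : ℝ)⁻¹)) atTop (nhds 1) := by
    simpa using tendsto_const_nhds.rpow (tendsto_inv_atTop_nhds_zero_nat (𝕜 := ℝ))
      (Or.inl hc.ne')
  have hmul := hroot.mul_const a
  rw [one_mul] at hmul
  refine hmul.congr' ?_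
  filter_upwards [eventually_ne_atTop 0] with n hn
  rw [Real.mul_rpow hc.le (pow_nonneg ha n), Real.pow_rpow_inv_natCast ha hn]

/-- A sequence squeezed between two positive multiples of `a ^ n` has `n`-th root growth
rate `a`. -/
theorem tendsto_rpow_inv_of_le_of_le {u : ℕ → ℝ} {a c C : ℝ} (ha : 0 ≤ a) (hc : 0 < c)
    (hC : 0 < C) (hl : ∀ᶠ n in atTop, c * a ^ n ≤ u n) (hu : ∀ᶠ n in atTop, u n ≤ C * a ^ n) :
    Tendsto (fun n : ℕ => u n ^ ((n : ℝ)⁻¹)) atTop (nhds a) := by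
  refine tendsto_of_tendsto_of_tendsto_of_le_of_le' (tendsto_const_mul_pow_rpow_inv ha hc)
    (tendsto_const_mul_pow_rpow_inv ha hC) ?_ ?_
  · filter_upwards [hl] with n hn
    exact Real.rpow_le_rpow (by positivity) hn (by positivity)
  · filter_upwards [hl, hu] with n hn hn'
    exact Real.rpow_le_rpow (le_trans (by positivity) hn) hn' (by positivity)

/-- The degree sequence of the non-confining mapping
`x_{n+1} + x_{n-1} = 1/x_n^k` for odd `k ≥ 3`, and its dynamical degree `k`. -/
theorem stmt_19 (k : ℕ) (hk : 3 ≤ k) (hko : Odd k) (d : ℕ → ℤ)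
    (h0 : d 0 = 0)
    (hrec : ∀ n : ℕ, 1 ≤ n →
      d n = k * d (n - 1) + (if Odd n then 1 else 0)) :
    (∀ ℓ : ℕ, ((k : ℤ) ^ 2 - 1) * d (2 * ℓ) = (k : ℤ) * ((k : ℤ) ^ (2 * ℓ) - 1)) ∧
    (∀ ℓ : ℕ, 1 ≤ ℓ →
      ((k : ℤ) ^ 2 - 1) * d (2 * ℓ - 1) = (k : ℤ) ^ (2 * ℓ) - 1) ∧
    Tendsto (fun n : ℕ => ((d n : ℝ)) ^ ((n : ℝ)⁻¹)) atTop (nhds (k : ℝ)) := by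
  have heven : ∀ ℓ : ℕ, d (2 * ℓ + 2) = k * d (2 * ℓ + 1) := fun ℓ => by
    simpa [show ¬ Odd (2 * ℓ + 2) by grind] using hrec (2 * ℓ + 2) (by omega)
  have hodd : ∀ ℓ : ℕ, d (2 * ℓ + 1) = k * d (2 * ℓ) + 1 := fun ℓ => by
    simpa using hrec (2 * ℓ + 1) (by omega)
  have hclosed : ∀ ℓ : ℕ,
      ((k : ℤ) ^ 2 - 1) * d (2 * ℓ) = (k : ℤ) * ((k : ℤ) ^ (2 * ℓ) - 1) := by
    intro ℓ
    induction ℓ with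
    | zero => simp [h0]
    | succ ℓ ih =>
      rw [mul_add_one, heven, hodd, pow_add]
      linear_combination (k : ℤ) ^ 2 * ih
  have hk' : (3 : ℤ) ≤ k := by exact_mod_cast hk
  have hlower : ∀ n : ℕ, (k : ℤ) ^ n ≤ d (n + 1) := by
    intro n
    induction n with
    | zero => simp [hrec 1 le_rfl, h0]
    | succ n ih =>
      rw [hrec (n + 1 + 1) (by omega), Nat.add_sub_cancel, pow_succ']
      have := mul_le_mul_of_nonneg_left ih (by omega : (0 : ℤ) ≤ k)
      split_ifs <;> linarith
  have hupper : ∀ n : ℕ, d n ≤ (k : ℤ) ^ n - 1 := by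
    intro n
    induction n with
    | zero => simp [h0]
    | succ n ih =>
      rw [hrec (n + 1) (by omega), Nat.add_sub_cancel, pow_succ']
      have := mul_le_mul_of_nonneg_left ih (by omega : (0 : ℤ) ≤ k)
      split_ifs <;> linarith
  refine ⟨hclosed, ?_, ?_⟩
  · intro ℓ hℓ
    obtain ⟨m, rfl⟩ := Nat.exists_eq_add_of_le' hℓ
    rw [show 2 * (m + 1) - 1 = 2 * m + 1 by omega, hodd, mul_add_one 2 m, pow_add]
    linear_combination (k : ℤ) * hclosed m
  · have hkpos : (0 : ℝ) < k := by exact_mod_cast (by omega : 0 < k)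
    refine tendsto_rpow_inv_of_le_of_le hkpos.le (inv_pos.2 hkpos) one_pos ?_ ?_
    · filter_upwards [eventually_ge_atTop 1] with n hn
      obtain ⟨m, rfl⟩ := Nat.exists_eq_add_of_le' hn
      rw [pow_succ', inv_mul_cancel_left₀ hkpos.ne']
      exact_mod_cast hlower m
    · refine Eventually.of_forall fun n => ?_
      rw [one_mul]
      exact_mod_cast (hupper n).trans (sub_le_self _ zero_le_one)
end
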